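/- Fix integers k ≥ 1 and ℓ ≥ 1. Define λ₁^{(k)}(a,b) as the infimum, over all smooth Γ_k-invariant φ : ℝ³ → ℂ not identically zero (Γ_k-invariance meaning φ(x+k,y,z) = φ(x,y+1,z+x) = φ(x,y,z+1) = φ(x,y,z)), of (∫_F (|Xφ + i a φ|² + |Yφ + i b φ|²)) / (∫_F |φ|²), where F = (0,k)×(0,1)×(0,1) carries Lebesgue measure, X φ = ∂_x φ + y ∂_z φ and Y φ = ∂_y φ. Then λ₁^{(k)}(2π/ℓ, 0) = 0 if and only if ℓ divides k. -/

import Mathlib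

open MeasureTheory

/-- The horizontal vector field `X = ∂_x + y ∂_z` on the Heisenberg group `ℝ³`,
applied to a function `φ : ℝ³ → ℂ`. -/
noncomputable def heisX (φ : ℝ × ℝ × ℝ → ℂ) (p : ℝ × ℝ × ℝ) : ℂ :=
  fderiv ℝ φ p (1, 0, 0) + p.2.1 • fderiv ℝ φ p (0, 0, 1)

/-- The horizontal vector field `Y = ∂_y` on the Heisenberg group `ℝ³`,
applied to a function `φ : ℝ³ → ℂ`. -/
noncomputable def heisY (φ : ℝ × ℝ × ℝ → ℂ) (p : ℝ × ℝ × ℝ) : ℂ :=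
  fderiv ℝ φ p (0, 1, 0)

/-- The fundamental domain `F = (0,k) × (0,1) × (0,1)` of `Γ_k \ ℍ¹`. -/
def heisF (k : ℕ) : Set (ℝ × ℝ × ℝ) :=
  Set.Ioo (0 : ℝ) (k : ℝ) ×ˢ (Set.Ioo (0 : ℝ) 1 ×ˢ Set.Ioo (0 : ℝ) 1)

/-- The first eigenvalue `λ₁^{(k)}(a,b)` of the magnetic horizontal Laplacian on
`Γ_k \ ℍ¹` with magnetic potential `a dx + b dy`: the infimum of the magnetic
Rayleigh quotients over smooth `Γ_k`-invariant `φ` not identically zero. -/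
noncomputable def heisLambda1 (k : ℕ) (a b : ℝ) : ℝ :=
  sInf {r : ℝ | ∃ φ : ℝ × ℝ × ℝ → ℂ, ContDiff ℝ (⊤ : ℕ∞) φ ∧
    (∀ x y z : ℝ, φ (x + k, y, z) = φ (x, y, z) ∧
      φ (x, y + 1, z + x) = φ (x, y, z) ∧ φ (x, y, z + 1) = φ (x, y, z)) ∧
    (∃ p, φ p ≠ 0) ∧
    r = (∫ p in heisF k,
          (‖heisX φ p + Complex.I * (a : ℂ) * φ p‖ ^ 2 +
            ‖heisY φ p + Complex.I * (b : ℂ) * φ p‖ ^ 2)) /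
        (∫ p in heisF k, ‖φ p‖ ^ 2)}

/-- Right multiplication by `(u, v, w)` in the Heisenberg group. -/
def heisMul (p : ℝ × ℝ × ℝ) (u v w : ℝ) : ℝ × ℝ × ℝ :=
  (p.1 + u, p.2.1 + v, p.2.2 + w + u * p.2.1)

/-- Invariance of a function on `ℝ³` under the lattice `Γ_k`. -/
def HeisInvariant {E : Type*} (k : ℕ) (f : ℝ × ℝ × ℝ → E) : Prop :=
  ∀ x y z : ℝ, f (x + k, y, z) = f (x, y, z) ∧
    f (x, y + 1, z + x) = f (x, y, z) ∧ f (x, y, z + 1) = f (x, y, z)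

@[fun_prop]
theorem Continuous.heis_mul {T : Type*} [TopologicalSpace T] {p : T → ℝ × ℝ × ℝ} {u v w : T → ℝ}
    (hp : Continuous p) (hu : Continuous u) (hv : Continuous v) (hw : Continuous w) :
    Continuous fun t => heisMul (p t) (u t) (v t) (w t) := by
  unfold heisMul
  fun_prop

theorem Continuous.comp_heisMul {E : Type*} [TopologicalSpace E] {f : ℝ × ℝ × ℝ → E}
    (hf : Continuous f) (u v w : ℝ) : Continuous fun p => f (heisMul p u v w) := by
  fun_prop

theorem Continuous.norm_sq {T E : Type*} [TopologicalSpace T] [SeminormedAddCommGroup E] {f : T → E}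
    (hf : Continuous f) : Continuous fun t => ‖f t‖ ^ 2 := by
  fun_prop

theorem HeisInvariant.comp {E E' : Type*} {k : ℕ} {f : ℝ × ℝ × ℝ → E} (hf : HeisInvariant k f)
    (g : E → E') : HeisInvariant k fun p => g (f p) := fun x y z =>
  ⟨congrArg g (hf x y z).1, congrArg g (hf x y z).2.1, congrArg g (hf x y z).2.2⟩

theorem HeisInvariant.comp₂ {E E' E'' : Type*} {k : ℕ} {f : ℝ × ℝ × ℝ → E} {f' : ℝ × ℝ × ℝ → E'}
    (hf : HeisInvariant k f) (hf' : HeisInvariant k f') (g : E → E' → E'') :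
    HeisInvariant k fun p => g (f p) (f' p) := fun x y z =>
  ⟨congrArg₂ g (hf x y z).1 (hf' x y z).1, congrArg₂ g (hf x y z).2.1 (hf' x y z).2.1,
    congrArg₂ g (hf x y z).2.2 (hf' x y z).2.2⟩

theorem HeisInvariant.heisMul {E : Type*} {k : ℕ} {f : ℝ × ℝ × ℝ → E} (hf : HeisInvariant k f)
    (u v w : ℝ) : HeisInvariant k fun p => f (heisMul p u v w) := by
  intro x y z
  simp only [_root_.heisMul]
  refine ⟨?_, ?_, ?_⟩
  · rw [← (hf (x + u) (y + v) (z + w + u * y)).1]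
    congr 2
    ring
  · rw [← (hf (x + u) (y + v) (z + w + u * y)).2.1]
    congr 3 <;> ring
  · rw [← (hf (x + u) (y + v) (z + w + u * y)).2.2]
    congr 3
    ring

theorem integrableOn_heisF {E : Type*} [NormedAddCommGroup E] (k : ℕ) {f : ℝ × ℝ × ℝ → E}
    (hf : Continuous f) : IntegrableOn f (heisF k) := by
  have hc : IsCompact (Set.Icc (0 : ℝ) (k : ℝ) ×ˢ (Set.Icc (0 : ℝ) 1 ×ˢ Set.Icc (0 : ℝ) 1)) :=
    isCompact_Icc.prod (isCompact_Icc.prod isCompact_Icc)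
  refine (hf.continuousOn.integrableOn_compact hc).mono_set ?_
  exact Set.prod_mono Set.Ioo_subset_Icc_self
    (Set.prod_mono Set.Ioo_subset_Icc_self Set.Ioo_subset_Icc_self)

theorem setIntegral_heisF (k : ℕ) {f : ℝ × ℝ × ℝ → ℝ} (hf : Continuous f) :
    ∫ p in heisF k, f p = ∫ x in (0 : ℝ)..k, ∫ y in (0 : ℝ)..1, ∫ z in (0 : ℝ)..1, f (x, y, z) := by
  have h := integrableOn_heisF k hf
  unfold heisF at h ⊢
  rw [Measure.volume_eq_prod] at h ⊢
  rw [setIntegral_prod _ h, intervalIntegral.integral_of_le (Nat.cast_nonneg k),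
    integral_Ioc_eq_integral_Ioo]
  congr 1 with x
  have hx : IntegrableOn (fun q : ℝ × ℝ => f (x, q)) (Set.Ioo (0 : ℝ) 1 ×ˢ Set.Ioo (0 : ℝ) 1)
      ((volume : Measure ℝ).prod volume) := by
    have hc : IsCompact (Set.Icc (0 : ℝ) 1 ×ˢ Set.Icc (0 : ℝ) 1) :=
      isCompact_Icc.prod isCompact_Icc
    have hg : Continuous fun q : ℝ × ℝ => f (x, q) := by fun_prop
    rw [← Measure.volume_eq_prod]
    exact (hg.continuousOn.integrableOn_compact hc).mono_set
      (Set.prod_mono Set.Ioo_subset_Icc_self Set.Ioo_subset_Icc_self)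
  rw [Measure.volume_eq_prod, setIntegral_prod _ hx, intervalIntegral.integral_of_le zero_le_one,
    integral_Ioc_eq_integral_Ioo]
  congr 1 with y
  rw [intervalIntegral.integral_of_le zero_le_one, integral_Ioc_eq_integral_Ioo]

theorem Function.Periodic.intervalIntegral_comp_add_right {g : ℝ → ℝ} {T : ℝ}
    (hg : Function.Periodic g T) (c : ℝ) :
    ∫ t in (0 : ℝ)..T, g (t + c) = ∫ t in (0 : ℝ)..T, g t := by
  rw [intervalIntegral.integral_comp_add_right, zero_add, add_comm T c,
    hg.intervalIntegral_add_eq c 0, zero_add]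

/-- The measure on the nilmanifold is invariant under right multiplication. -/
theorem setIntegral_heisF_comp_heisMul {k : ℕ} {f : ℝ × ℝ × ℝ → ℝ} (hf : Continuous f)
    (hinv : HeisInvariant k f) (u v w : ℝ) :
    ∫ p in heisF k, f (heisMul p u v w) = ∫ p in heisF k, f p := by
  have hz : ∀ x y c : ℝ, ∫ z in (0 : ℝ)..1, f (x, y, z + c) = ∫ z in (0 : ℝ)..1, f (x, y, z) :=
    fun x y c => Function.Periodic.intervalIntegral_comp_add_right
      (g := fun z => f (x, y, z)) (fun z => (hinv x y z).2.2) c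
  have hy : ∀ x c : ℝ, ∫ y in (0 : ℝ)..1, ∫ z in (0 : ℝ)..1, f (x, y + c, z) =
      ∫ y in (0 : ℝ)..1, ∫ z in (0 : ℝ)..1, f (x, y, z) := fun x c =>
    Function.Periodic.intervalIntegral_comp_add_right
      (g := fun y => ∫ z in (0 : ℝ)..1, f (x, y, z)) (fun y => by
        refine (hz x (y + 1) x).symm.trans ?_
        exact intervalIntegral.integral_congr fun z _ => (hinv x y z).2.1) c
  have hx : ∀ c : ℝ, ∫ x in (0 : ℝ)..k, ∫ y in (0 : ℝ)..1, ∫ z in (0 : ℝ)..1, f (x + c, y, z) =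
      ∫ x in (0 : ℝ)..k, ∫ y in (0 : ℝ)..1, ∫ z in (0 : ℝ)..1, f (x, y, z) := fun c =>
    Function.Periodic.intervalIntegral_comp_add_right
      (g := fun x => ∫ y in (0 : ℝ)..1, ∫ z in (0 : ℝ)..1, f (x, y, z)) (fun x => by
        simp only [(hinv x _ _).1]) c
  rw [setIntegral_heisF k hf, setIntegral_heisF k (hf.comp_heisMul u v w)]
  simp only [heisMul, add_assoc, hz, hy, hx]

theorem setIntegral_heisF_intervalIntegral_swap {k : ℕ} {f : ℝ × ℝ × ℝ → ℝ → ℝ}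
    (hf : Continuous (Function.uncurry f)) :
    ∫ p in heisF k, ∫ s in (0 : ℝ)..1, f p s = ∫ s in (0 : ℝ)..1, ∫ p in heisF k, f p s := by
  simp only [intervalIntegral.integral_of_le zero_le_one]
  refine integral_integral_swap ?_
  rw [Measure.prod_restrict, ← Measure.volume_eq_prod]
  have hc : IsCompact ((Set.Icc (0 : ℝ) (k : ℝ) ×ˢ (Set.Icc (0 : ℝ) 1 ×ˢ Set.Icc (0 : ℝ) 1)) ×ˢ
      Set.Icc (0 : ℝ) 1) :=
    (isCompact_Icc.prod (isCompact_Icc.prod isCompact_Icc)).prod isCompact_Icc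
  refine (hf.continuousOn.integrableOn_compact hc).mono_set ?_
  exact Set.prod_mono (Set.prod_mono Set.Ioo_subset_Icc_self
    (Set.prod_mono Set.Ioo_subset_Icc_self Set.Ioo_subset_Icc_self)) Set.Ioc_subset_Icc_self

theorem norm_intervalIntegral_sq_le {h : ℝ → ℂ} (hh : Continuous h) :
    ‖∫ s in (0 : ℝ)..1, h s‖ ^ 2 ≤ ∫ s in (0 : ℝ)..1, ‖h s‖ ^ 2 := by
  set m : ℝ := ∫ s in (0 : ℝ)..1, ‖h s‖ with hm
  have h1 : ‖∫ s in (0 : ℝ)..1, h s‖ ≤ m :=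
    intervalIntegral.norm_integral_le_integral_norm zero_le_one
  have h2 : 0 ≤ ∫ s in (0 : ℝ)..1, (‖h s‖ - m) ^ 2 :=
    intervalIntegral.integral_nonneg zero_le_one fun s _ => sq_nonneg _
  have h3 : ∫ s in (0 : ℝ)..1, (‖h s‖ - m) ^ 2 = (∫ s in (0 : ℝ)..1, ‖h s‖ ^ 2) - m ^ 2 := by
    have : ∀ s, (‖h s‖ - m) ^ 2 = (‖h s‖ ^ 2 - 2 * m * ‖h s‖) + m ^ 2 := fun s => by ring
    simp only [this]
    have i1 : Continuous fun s => ‖h s‖ ^ 2 := by fun_prop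
    have i2 : Continuous fun s => 2 * m * ‖h s‖ := by fun_prop
    have i3 : Continuous fun s => ‖h s‖ ^ 2 - 2 * m * ‖h s‖ := i1.sub i2
    rw [intervalIntegral.integral_add (i3.intervalIntegrable _ _) intervalIntegrable_const,
      intervalIntegral.integral_sub (i1.intervalIntegrable _ _) (i2.intervalIntegrable _ _),
      intervalIntegral.integral_const_mul, ← hm]
    simp only [intervalIntegral.integral_const, sub_zero, one_smul]
    ring
  calc _ ≤ m ^ 2 := by gcongr
    _ ≤ _ := by linarith

theorem continuous_heisX {φ : ℝ × ℝ × ℝ → ℂ} (hφ : ContDiff ℝ 1 φ) : Continuous (heisX φ) := by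
  have := hφ.continuous_fderiv one_ne_zero
  unfold heisX
  fun_prop

theorem continuous_heisY {φ : ℝ × ℝ × ℝ → ℂ} (hφ : ContDiff ℝ 1 φ) : Continuous (heisY φ) := by
  have := hφ.continuous_fderiv one_ne_zero
  unfold heisY
  fun_prop

/-- The derivative along the one-parameter subgroup generated by `u X + v Y`. -/
theorem hasDerivAt_comp_heisMul {φ : ℝ × ℝ × ℝ → ℂ} (hφ : Differentiable ℝ φ) (u v : ℝ)
    (p : ℝ × ℝ × ℝ) (s : ℝ) :
    HasDerivAt (fun t => φ (heisMul p (t * u) (t * v) (t ^ 2 * (u * v / 2))))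
      (u * heisX φ (heisMul p (s * u) (s * v) (s ^ 2 * (u * v / 2))) +
        v * heisY φ (heisMul p (s * u) (s * v) (s ^ 2 * (u * v / 2)))) s := by
  have h1 : HasDerivAt (fun t => heisMul p (t * u) (t * v) (t ^ 2 * (u * v / 2)))
      (u, v, u * (p.2.1 + s * v)) s := by
    unfold heisMul
    have a1 : HasDerivAt (fun t : ℝ => p.1 + t * u) u s := by
      simpa using ((hasDerivAt_id s).mul_const u).const_add p.1
    have a2 : HasDerivAt (fun t : ℝ => p.2.1 + t * v) v s := by
      simpa using ((hasDerivAt_id s).mul_const v).const_add p.2.1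
    have a3 : HasDerivAt (fun t : ℝ => p.2.2 + t ^ 2 * (u * v / 2) + t * u * p.2.1)
        (u * (p.2.1 + s * v)) s := by
      have := ((((hasDerivAt_id s).pow 2).mul_const (u * v / 2)).const_add p.2.2).add
        (((hasDerivAt_id s).mul_const u).mul_const p.2.1)
      refine this.congr_deriv ?_
      simp
      ring
    exact a1.prodMk (a2.prodMk a3)
  have h2 := (hφ (heisMul p (s * u) (s * v) (s ^ 2 * (u * v / 2)))).hasFDerivAt.comp_hasDerivAt s h1
  refine h2.congr_deriv ?_
  have : ((u, v, u * (p.2.1 + s * v)) : ℝ × ℝ × ℝ) =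
      u • ((1, 0, 0) : ℝ × ℝ × ℝ) + v • ((0, 1, 0) : ℝ × ℝ × ℝ) +
        (u * (p.2.1 + s * v)) • ((0, 0, 1) : ℝ × ℝ × ℝ) := by
    simp
  rw [this]
  simp only [map_add, map_smul, heisX, heisY, heisMul, Complex.real_smul]
  push_cast
  ring

theorem heisInvariant_heisX_heisY {k : ℕ} {φ : ℝ × ℝ × ℝ → ℂ} (hφ : Differentiable ℝ φ)
    (hinv : HeisInvariant k φ) (u v : ℝ) :
    HeisInvariant k fun p => u * heisX φ p + v * heisY φ p := by
  have key : ∀ p q : ℝ × ℝ × ℝ, (∀ u v w, φ (heisMul p u v w) = φ (heisMul q u v w)) →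
      u * heisX φ p + v * heisY φ p = u * heisX φ q + v * heisY φ q := by
    intro p q hpq
    have hp := hasDerivAt_comp_heisMul hφ u v p 0
    have hq := hasDerivAt_comp_heisMul hφ u v q 0
    simp only [hpq] at hp
    have := hp.unique hq
    simpa [heisMul] using this
  intro x y z
  exact ⟨key _ _ fun u v w => ((hinv.heisMul u v w) x y z).1,
    key _ _ fun u v w => ((hinv.heisMul u v w) x y z).2.1,
    key _ _ fun u v w => ((hinv.heisMul u v w) x y z).2.2⟩

/-- The twisted difference of `φ` along the time-one flow of `u X + v Y`. -/
noncomputable def heisDiff (φ : ℝ × ℝ × ℝ → ℂ) (a u v : ℝ) (p : ℝ × ℝ × ℝ) : ℂ :=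
  Complex.exp (Complex.I * a * u) * φ (heisMul p u v (u * v / 2)) - φ p

theorem continuous_heisDiff {φ : ℝ × ℝ × ℝ → ℂ} (hφ : Continuous φ) (a u v : ℝ) :
    Continuous (heisDiff φ a u v) := by
  unfold heisDiff
  fun_prop

theorem HeisInvariant.heisDiff {k : ℕ} {φ : ℝ × ℝ × ℝ → ℂ} (hinv : HeisInvariant k φ)
    (a u v : ℝ) : HeisInvariant k (heisDiff φ a u v) :=
  (hinv.heisMul u v (u * v / 2)).comp₂ hinv
    fun b c => Complex.exp (Complex.I * a * u) * b - c

theorem setIntegral_norm_heisDiff_sq_le {k : ℕ} {φ : ℝ × ℝ × ℝ → ℂ} (hφ : ContDiff ℝ 1 φ)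
    (hinv : HeisInvariant k φ) (a u v : ℝ) :
    ∫ p in heisF k, ‖heisDiff φ a u v p‖ ^ 2 ≤
      ∫ p in heisF k, ‖u * (heisX φ p + Complex.I * a * φ p) + v * heisY φ p‖ ^ 2 := by
  have hd : Differentiable ℝ φ := hφ.differentiable one_ne_zero
  set W : ℝ × ℝ × ℝ → ℂ := fun p => u * (heisX φ p + Complex.I * a * φ p) + v * heisY φ p with hW
  have hWc : Continuous W := by
    have := continuous_heisX hφ
    have := continuous_heisY hφ
    have := hφ.continuous
    fun_prop
  have hWi : HeisInvariant k W := by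
    have h := (heisInvariant_heisX_heisY hd hinv u v).comp₂ hinv
      fun b c => b + u * (Complex.I * a * c)
    convert h using 2 with p
    simp only [hW]
    ring
  set γ : ℝ × ℝ × ℝ → ℝ → ℝ × ℝ × ℝ :=
    fun p s => heisMul p (s * u) (s * v) (s ^ 2 * (u * v / 2)) with hγ
  have hγc : Continuous (Function.uncurry γ) := by
    simp only [hγ, Function.uncurry_def]
    exact continuous_fst.heis_mul (by fun_prop) (by fun_prop) (by fun_prop)
  have hWγ : Continuous (Function.uncurry fun p s => W (γ p s)) := hWc.comp hγc
  have hpt : ∀ p, ‖heisDiff φ a u v p‖ ^ 2 ≤ ∫ s in (0 : ℝ)..1, ‖W (γ p s)‖ ^ 2 := by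
    intro p
    set h : ℝ → ℂ := fun s => Complex.exp (Complex.I * a * u * s) * W (γ p s) with hh
    have hWs : Continuous fun s => W (γ p s) := hWc.comp (hγc.uncurry_left p)
    have hhc : Continuous h := by fun_prop
    have hder : ∀ s ∈ Set.uIcc (0 : ℝ) 1,
        HasDerivAt (fun s : ℝ => Complex.exp (Complex.I * a * u * s) * φ (γ p s)) (h s) s := by
      intro s _
      have e1 : HasDerivAt (fun s : ℝ => Complex.exp (Complex.I * a * u * s))
          (Complex.exp (Complex.I * a * u * s) * (Complex.I * a * u)) s := by
        have := ((Complex.ofRealCLM.hasDerivAt (x := s)).const_mul (Complex.I * a * u)).cexp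
        simpa using this
      refine (e1.mul (hasDerivAt_comp_heisMul hd u v p s)).congr_deriv ?_
      simp only [hh, hW, hγ]
      ring
    have hftc := intervalIntegral.integral_eq_sub_of_hasDerivAt hder (hhc.intervalIntegrable _ _)
    have hdiff : heisDiff φ a u v p = ∫ s in (0 : ℝ)..1, h s := by
      rw [hftc]
      simp [heisDiff, hγ, heisMul]
    rw [hdiff]
    refine (norm_intervalIntegral_sq_le hhc).trans_eq ?_
    congr 1 with s
    have : ‖Complex.exp (Complex.I * a * u * s)‖ = 1 := by
      rw [Complex.norm_exp]
      simp
    simp only [hh, norm_mul, this, one_mul]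
  have hN : Continuous (Function.uncurry fun p s => ‖W (γ p s)‖ ^ 2) := hWγ.norm_sq
  calc ∫ p in heisF k, ‖heisDiff φ a u v p‖ ^ 2
      ≤ ∫ p in heisF k, ∫ s in (0 : ℝ)..1, ‖W (γ p s)‖ ^ 2 :=
        integral_mono (integrableOn_heisF k ((continuous_heisDiff hφ.continuous a u v).norm_sq))
          (integrableOn_heisF k
            (intervalIntegral.continuous_parametric_intervalIntegral_of_continuous' hN 0 1)) hpt
    _ = ∫ s in (0 : ℝ)..1, ∫ p in heisF k, ‖W (γ p s)‖ ^ 2 :=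
        setIntegral_heisF_intervalIntegral_swap hN
    _ = ∫ s in (0 : ℝ)..1, ∫ p in heisF k, ‖W p‖ ^ 2 := by
        congr 1 with s
        exact setIntegral_heisF_comp_heisMul (hWc.norm_sq) (hWi.comp fun c => ‖c‖ ^ 2) _ _ _
    _ = ∫ p in heisF k, ‖W p‖ ^ 2 := by simp

/-- The magnetic horizontal energy of `φ`, for the potential `a dx`. -/
noncomputable def heisEnergy (k : ℕ) (φ : ℝ × ℝ × ℝ → ℂ) (a : ℝ) : ℝ :=
  (∫ p in heisF k, ‖heisX φ p + Complex.I * a * φ p‖ ^ 2) + ∫ p in heisF k, ‖heisY φ p‖ ^ 2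

theorem setIntegral_norm_heisDiff_X_sq_le {k : ℕ} {φ : ℝ × ℝ × ℝ → ℂ} (hφ : ContDiff ℝ 1 φ)
    (hinv : HeisInvariant k φ) (a u : ℝ) :
    ∫ p in heisF k, ‖heisDiff φ a u 0 p‖ ^ 2 ≤
      u ^ 2 * ∫ p in heisF k, ‖heisX φ p + Complex.I * a * φ p‖ ^ 2 := by
  refine (setIntegral_norm_heisDiff_sq_le hφ hinv a u 0).trans_eq ?_
  rw [← integral_const_mul]
  simp [mul_pow]

theorem setIntegral_norm_heisDiff_Y_sq_le {k : ℕ} {φ : ℝ × ℝ × ℝ → ℂ} (hφ : ContDiff ℝ 1 φ)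
    (hinv : HeisInvariant k φ) (a : ℝ) :
    ∫ p in heisF k, ‖heisDiff φ a 0 1 p‖ ^ 2 ≤ ∫ p in heisF k, ‖heisY φ p‖ ^ 2 := by
  refine (setIntegral_norm_heisDiff_sq_le hφ hinv a 0 1).trans_eq ?_
  simp

theorem norm_add_sq_le_two (a b : ℂ) : ‖a + b‖ ^ 2 ≤ 2 * ‖a‖ ^ 2 + 2 * ‖b‖ ^ 2 := by
  have h := norm_add_le a b
  have : ‖a + b‖ ^ 2 ≤ (‖a‖ + ‖b‖) ^ 2 := by gcongr
  nlinarith [sq_nonneg (‖a‖ - ‖b‖)]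

/-- Central translations are controlled by the horizontal energy, through the commutator loop. -/
theorem setIntegral_norm_central_diff_sq_le {k : ℕ} {φ : ℝ × ℝ × ℝ → ℂ} (hφ : ContDiff ℝ 1 φ)
    (hinv : HeisInvariant k φ) (a : ℝ) {s : ℝ} (hs : s ∈ Set.Icc (0 : ℝ) 1) :
    ∫ p in heisF k, ‖φ p - φ (heisMul p 0 0 (-s))‖ ^ 2 ≤ 8 * heisEnergy k φ a := by
  set dX : ℝ × ℝ × ℝ → ℝ := fun p => ‖heisDiff φ a s 0 p‖ ^ 2 with hdX
  set dY : ℝ × ℝ × ℝ → ℝ := fun p => ‖heisDiff φ a 0 1 p‖ ^ 2 with hdY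
  have cX : Continuous dX := (continuous_heisDiff hφ.continuous a s 0).norm_sq
  have cY : Continuous dY := (continuous_heisDiff hφ.continuous a 0 1).norm_sq
  have iX : HeisInvariant k dX := (hinv.heisDiff a s 0).comp fun c => ‖c‖ ^ 2
  have iY : HeisInvariant k dY := (hinv.heisDiff a 0 1).comp fun c => ‖c‖ ^ 2
  have hpt : ∀ p, ‖φ p - φ (heisMul p 0 0 (-s))‖ ^ 2 ≤
      4 * (dY (heisMul p 0 0 (-s)) + dX (heisMul p 0 1 (-s)) + (dY (heisMul p s 0 0) + dX p)) := by
    intro p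
    have hloop : φ p - φ (heisMul p 0 0 (-s)) =
        (heisDiff φ a 0 1 (heisMul p 0 0 (-s)) + heisDiff φ a s 0 (heisMul p 0 1 (-s))) +
        (-(Complex.exp (Complex.I * a * s) * heisDiff φ a 0 1 (heisMul p s 0 0)) +
          -heisDiff φ a s 0 p) := by
      obtain ⟨x, y, z⟩ := p
      simp only [heisDiff, heisMul]
      have : z + -s + 0 * y + s * 0 / 2 + s * (y + 1) = z + s * y := by ring
      simp only [this]
      ring_nf
      simp
      ring
    have he : ‖Complex.exp (Complex.I * a * s)‖ = 1 := by
      rw [Complex.norm_exp]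
      simp
    have n1 : ‖-(Complex.exp (Complex.I * a * s) * heisDiff φ a 0 1 (heisMul p s 0 0))‖ ^ 2 =
        dY (heisMul p s 0 0) := by
      rw [norm_neg, norm_mul, he, one_mul]
    have n2 : ‖-heisDiff φ a s 0 p‖ ^ 2 = dX p := by rw [norm_neg]
    rw [hloop]
    have t0 := norm_add_sq_le_two
      (heisDiff φ a 0 1 (heisMul p 0 0 (-s)) + heisDiff φ a s 0 (heisMul p 0 1 (-s)))
      (-(Complex.exp (Complex.I * a * s) * heisDiff φ a 0 1 (heisMul p s 0 0)) +
          -heisDiff φ a s 0 p)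
    have t1 := norm_add_sq_le_two
      (heisDiff φ a 0 1 (heisMul p 0 0 (-s))) (heisDiff φ a s 0 (heisMul p 0 1 (-s)))
    have t2 := norm_add_sq_le_two
      (-(Complex.exp (Complex.I * a * s) * heisDiff φ a 0 1 (heisMul p s 0 0)))
      (-heisDiff φ a s 0 p)
    rw [n1, n2] at t2
    simp only [hdX, hdY] at t2 ⊢
    linarith
  have j1 := integrableOn_heisF k (cY.comp_heisMul 0 0 (-s))
  have j2 := integrableOn_heisF k (cX.comp_heisMul 0 1 (-s))
  have j3 := integrableOn_heisF k (cY.comp_heisMul s 0 0)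
  have j4 := integrableOn_heisF k cX
  have j12 : IntegrableOn (fun p => dY (heisMul p 0 0 (-s)) + dX (heisMul p 0 1 (-s)))
      (heisF k) := j1.add j2
  have j34 : IntegrableOn (fun p => dY (heisMul p s 0 0) + dX p) (heisF k) := j3.add j4
  have j : IntegrableOn (fun p => 4 * (dY (heisMul p 0 0 (-s)) + dX (heisMul p 0 1 (-s)) +
      (dY (heisMul p s 0 0) + dX p))) (heisF k) := (j12.add j34).const_mul 4
  have hbound := integral_mono
    (integrableOn_heisF k ((hφ.continuous.sub (hφ.continuous.comp_heisMul 0 0 (-s))).norm_sq))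
    j hpt
  refine hbound.trans ?_
  rw [integral_const_mul]
  have hsum : ∫ p in heisF k, (dY (heisMul p 0 0 (-s)) + dX (heisMul p 0 1 (-s)) +
      (dY (heisMul p s 0 0) + dX p)) =
      2 * (∫ p in heisF k, dY p) + 2 * ∫ p in heisF k, dX p := by
    rw [integral_add j12 j34, integral_add j1 j2, integral_add j3 j4]
    rw [setIntegral_heisF_comp_heisMul cY iY, setIntegral_heisF_comp_heisMul cX iX,
      setIntegral_heisF_comp_heisMul cY iY]
    ring
  have hX := setIntegral_norm_heisDiff_X_sq_le hφ hinv a s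
  have hY := setIntegral_norm_heisDiff_Y_sq_le hφ hinv a
  have hs2 : s ^ 2 ≤ 1 := pow_le_one₀ hs.1 hs.2
  have hE : 0 ≤ ∫ p in heisF k, ‖heisX φ p + Complex.I * a * φ p‖ ^ 2 :=
    integral_nonneg fun p => sq_nonneg _
  have hX' := mul_le_mul_of_nonneg_right hs2 hE
  unfold heisEnergy
  rw [hsum]
  linarith

theorem setIntegral_norm_translate_sub_sq_le {k : ℕ} {φ : ℝ × ℝ × ℝ → ℂ} (hφ : ContDiff ℝ 1 φ)
    (hinv : HeisInvariant k φ) (a : ℝ) :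
    ∫ p in heisF k, ‖φ (heisMul p k 0 0) - φ p‖ ^ 2 ≤ 32 * heisEnergy k φ a := by
  have hc := hφ.continuous
  set h : ℝ × ℝ × ℝ → ℝ → ℝ := fun p s => ‖φ p - φ (heisMul p 0 0 (-s))‖ ^ 2 with hh
  have hhc : Continuous (Function.uncurry h) := by
    simp only [hh, Function.uncurry_def]
    fun_prop
  set H : ℝ × ℝ × ℝ → ℝ := fun p => ∫ s in (0 : ℝ)..1, h p s with hH
  have hHc : Continuous H :=
    intervalIntegral.continuous_parametric_intervalIntegral_of_continuous' hhc 0 1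
  have hHi : HeisInvariant k H := by
    have hs : ∀ s, HeisInvariant k fun p => h p s := fun s =>
      hinv.comp₂ (hinv.heisMul 0 0 (-s)) fun b c => ‖b - c‖ ^ 2
    intro x y z
    simp only [hH]
    exact ⟨by congr 1 with s; exact (hs s x y z).1, by congr 1 with s; exact (hs s x y z).2.1,
      by congr 1 with s; exact (hs s x y z).2.2⟩
  have hHint : ∫ p in heisF k, H p ≤ 8 * heisEnergy k φ a := by
    rw [setIntegral_heisF_intervalIntegral_swap hhc]
    have hmeas : Continuous fun s => ∫ p in heisF k, h p s := by
      have e : ∀ s, ∫ p in heisF k, h p s =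
          ∫ x in (0 : ℝ)..k, ∫ y in (0 : ℝ)..1, ∫ z in (0 : ℝ)..1, h (x, y, z) s := fun s =>
        setIntegral_heisF k (hhc.comp (by fun_prop : Continuous fun p : ℝ × ℝ × ℝ => (p, s)))
      simp only [e]
      refine intervalIntegral.continuous_parametric_intervalIntegral_of_continuous' ?_ _ _
      refine intervalIntegral.continuous_parametric_intervalIntegral_of_continuous'
        (f := fun (q : ℝ × ℝ) (y : ℝ) => ∫ z in (0 : ℝ)..1, h (q.2, y, z) q.1) ?_ _ _
      refine intervalIntegral.continuous_parametric_intervalIntegral_of_continuous'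
        (f := fun (q : (ℝ × ℝ) × ℝ) (z : ℝ) => h (q.1.2, q.2, z) q.1.1) ?_ _ _
      exact hhc.comp (by fun_prop : Continuous fun q : ((ℝ × ℝ) × ℝ) × ℝ =>
        (((q.1.1.2, q.1.2, q.2), q.1.1.1) : (ℝ × ℝ × ℝ) × ℝ))
    calc ∫ s in (0 : ℝ)..1, ∫ p in heisF k, h p s
        ≤ ∫ s in (0 : ℝ)..1, 8 * heisEnergy k φ a :=
          intervalIntegral.integral_mono_on zero_le_one (hmeas.intervalIntegrable _ _)
            (by simp) fun s hs => setIntegral_norm_central_diff_sq_le hφ hinv a hs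
      _ = _ := by simp
  have hpt : ∀ p, ‖φ (heisMul p k 0 0) - φ p‖ ^ 2 ≤ 2 * H (heisMul p k 0 0) + 2 * H p := by
    intro p
    have cp : Continuous fun s => h p s :=
      hhc.comp (by fun_prop : Continuous fun s : ℝ => (p, s))
    set g : ℝ → ℝ := fun s => ‖φ (heisMul p k 0 0) - φ (heisMul p 0 0 (-s))‖ ^ 2 with hg
    have cg : Continuous g := by fun_prop
    have hper : Function.Periodic g 1 := by
      intro s
      simp only [hg]
      have : φ (heisMul p 0 0 (-s)) = φ (heisMul p 0 0 (-(s + 1))) := by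
        have := (hinv (p.1 + 0) (p.2.1 + 0) (p.2.2 + -(s + 1) + 0 * p.2.1)).2.2
        rw [heisMul, heisMul, ← this]
        congr 3
        ring
      rw [this]
    have hshift : ∫ s in (0 : ℝ)..1, g s = H (heisMul p k 0 0) := by
      rw [← hper.intervalIntegral_comp_add_right (-(k * p.2.1))]
      simp only [hH, hh, hg]
      congr 1 with s
      have : φ (heisMul (heisMul p k 0 0) 0 0 (-s)) =
          φ (heisMul p 0 0 (-(s + -(k * p.2.1)))) := by
        have := (hinv (p.1 + 0) (p.2.1 + 0) (p.2.2 + -(s + -(k * p.2.1)) + 0 * p.2.1)).1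
        simp only [heisMul]
        rw [← this]
        congr 2
        · ring
        · congr 1 <;> ring
      rw [this]
    have hle : ∀ s, ‖φ (heisMul p k 0 0) - φ p‖ ^ 2 ≤ 2 * g s + 2 * h p s := by
      intro s
      have := norm_add_sq_le_two (φ (heisMul p k 0 0) - φ (heisMul p 0 0 (-s)))
        (φ (heisMul p 0 0 (-s)) - φ p)
      rw [sub_add_sub_cancel, norm_sub_rev (φ (heisMul p 0 0 (-s)))] at this
      exact this
    have cg2 : Continuous fun s => 2 * g s := by fun_prop
    have cp2 : Continuous fun s => 2 * h p s := by fun_prop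
    calc ‖φ (heisMul p k 0 0) - φ p‖ ^ 2
        = ∫ s in (0 : ℝ)..1, ‖φ (heisMul p k 0 0) - φ p‖ ^ 2 := by simp
      _ ≤ ∫ s in (0 : ℝ)..1, (2 * g s + 2 * h p s) :=
          intervalIntegral.integral_mono_on zero_le_one (by simp)
            ((cg2.add cp2).intervalIntegrable _ _) fun s _ => hle s
      _ = _ := by
          rw [intervalIntegral.integral_add (cg2.intervalIntegrable _ _)
            (cp2.intervalIntegrable _ _), intervalIntegral.integral_const_mul,
            intervalIntegral.integral_const_mul, hshift]
  have j1 := (integrableOn_heisF k (hHc.comp_heisMul k 0 0)).const_mul 2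
  have j2 := (integrableOn_heisF k hHc).const_mul 2
  have hbound := integral_mono
    (integrableOn_heisF k (((hc.comp_heisMul k 0 0).sub hc).norm_sq)) (j1.add j2) hpt
  refine hbound.trans ?_
  have hsum : ∫ p in heisF k, (2 * H (heisMul p k 0 0) + 2 * H p) = 4 * ∫ p in heisF k, H p := by
    rw [integral_add j1 j2, integral_const_mul, integral_const_mul]
    rw [setIntegral_heisF_comp_heisMul hHc hHi]
    ring
  calc _ = 4 * ∫ p in heisF k, H p := hsum
    _ ≤ _ := by linarith

/-- The magnetic Poincaré inequality governed by the holonomy `exp (i a k)`. -/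
theorem norm_holonomy_mul_setIntegral_le {k : ℕ} {φ : ℝ × ℝ × ℝ → ℂ} (hφ : ContDiff ℝ 1 φ)
    (hinv : HeisInvariant k φ) (a : ℝ) :
    ‖Complex.exp (Complex.I * a * k) - 1‖ ^ 2 * ∫ p in heisF k, ‖φ p‖ ^ 2 ≤
      (2 * k ^ 2 + 64) * heisEnergy k φ a := by
  have hc := hφ.continuous
  have hpt : ∀ p, ‖Complex.exp (Complex.I * a * k) - 1‖ ^ 2 * ‖φ (heisMul p k 0 0)‖ ^ 2 ≤
      2 * ‖heisDiff φ a k 0 p‖ ^ 2 + 2 * ‖φ (heisMul p k 0 0) - φ p‖ ^ 2 := by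
    intro p
    have := norm_add_sq_le_two (heisDiff φ a k 0 p) (-(φ (heisMul p k 0 0) - φ p))
    rw [norm_neg] at this
    rw [← mul_pow, ← norm_mul]
    refine le_trans (le_of_eq ?_) this
    congr 2
    simp only [heisDiff, mul_zero, zero_div, Complex.ofReal_natCast]
    ring
  have j0 := (integrableOn_heisF k ((hc.comp_heisMul k 0 0).norm_sq)).const_mul
    (‖Complex.exp (Complex.I * a * k) - 1‖ ^ 2)
  have j1 := (integrableOn_heisF k ((continuous_heisDiff hc a k 0).norm_sq)).const_mul 2
  have j2 := (integrableOn_heisF k (((hc.comp_heisMul k 0 0).sub hc).norm_sq)).const_mul 2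
  have hbound := integral_mono j0 (j1.add j2) hpt
  have hφ2 : ∫ p in heisF k, ‖φ (heisMul p k 0 0)‖ ^ 2 = ∫ p in heisF k, ‖φ p‖ ^ 2 :=
    setIntegral_heisF_comp_heisMul hc.norm_sq (hinv.comp fun c => ‖c‖ ^ 2) _ _ _
  have hl : ∫ p in heisF k, ‖Complex.exp (Complex.I * a * k) - 1‖ ^ 2 *
      ‖φ (heisMul p k 0 0)‖ ^ 2 =
      ‖Complex.exp (Complex.I * a * k) - 1‖ ^ 2 * ∫ p in heisF k, ‖φ p‖ ^ 2 := by
    rw [integral_const_mul, hφ2]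
  have hr : ∫ p in heisF k, (2 * ‖heisDiff φ a k 0 p‖ ^ 2 + 2 * ‖φ (heisMul p k 0 0) - φ p‖ ^ 2) =
      2 * (∫ p in heisF k, ‖heisDiff φ a k 0 p‖ ^ 2) +
        2 * ∫ p in heisF k, ‖φ (heisMul p k 0 0) - φ p‖ ^ 2 := by
    rw [← integral_const_mul, ← integral_const_mul]
    exact integral_add j1 j2
  have hX := setIntegral_norm_heisDiff_X_sq_le hφ hinv a k
  have hK := setIntegral_norm_translate_sub_sq_le hφ hinv a
  have hY : 0 ≤ ∫ p in heisF k, ‖heisY φ p‖ ^ 2 := integral_nonneg fun p => sq_nonneg _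
  have hkY := mul_nonneg (sq_nonneg (k : ℝ)) hY
  rw [← hl]
  refine hbound.trans (hr.le.trans ?_)
  have hE : (k : ℝ) ^ 2 * heisEnergy k φ a =
      (k : ℝ) ^ 2 * (∫ p in heisF k, ‖heisX φ p + Complex.I * a * φ p‖ ^ 2) +
        (k : ℝ) ^ 2 * ∫ p in heisF k, ‖heisY φ p‖ ^ 2 := by
    rw [heisEnergy, mul_add]
  linarith

theorem setIntegral_norm_sq_pos {k : ℕ} (hk : 1 ≤ k) {φ : ℝ × ℝ × ℝ → ℂ} (hc : Continuous φ)
    (hinv : HeisInvariant k φ) (hne : ∃ p, φ p ≠ 0) : 0 < ∫ p in heisF k, ‖φ p‖ ^ 2 := by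
  obtain ⟨q, hq⟩ := hne
  have hk0 : (0 : ℝ) < k := by exact_mod_cast hk
  set u : ℝ := q.1 - k / 2
  set v : ℝ := q.2.1 - 1 / 2
  set w : ℝ := q.2.2 - 1 / 2 - u * (1 / 2)
  have hmul : heisMul (k / 2, 1 / 2, 1 / 2) u v w = q := by
    simp only [heisMul, u, v, w]
    ext <;> simp
    ring
  rw [← setIntegral_heisF_comp_heisMul hc.norm_sq (hinv.comp fun c => ‖c‖ ^ 2) u v w]
  have hgc : Continuous fun p => ‖φ (heisMul p u v w)‖ ^ 2 :=
    (hc.comp_heisMul u v w).norm_sq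
  rw [setIntegral_pos_iff_support_of_nonneg_ae (Filter.Eventually.of_forall fun p => sq_nonneg _)
    (integrableOn_heisF k hgc)]
  refine IsOpen.measure_pos _ (hgc.isOpen_support.inter
    (isOpen_Ioo.prod (isOpen_Ioo.prod isOpen_Ioo))) ⟨(k / 2, 1 / 2, 1 / 2), ?_, ?_⟩
  · rw [Function.mem_support, hmul]
    exact pow_ne_zero 2 (norm_ne_zero_iff.mpr hq)
  · refine ⟨⟨by positivity, by simpa using hk0⟩, ⟨?_, ?_⟩, ?_, ?_⟩ <;> norm_num

theorem exp_holonomy_eq_one_iff {k ℓ : ℕ} (hℓ : 1 ≤ ℓ) :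
    Complex.exp (Complex.I * (2 * Real.pi / ℓ : ℝ) * k) = 1 ↔ ℓ ∣ k := by
  have hℓ0 : (ℓ : ℂ) ≠ 0 := by exact_mod_cast (by omega : ℓ ≠ 0)
  have hpi : (Real.pi : ℂ) ≠ 0 := by exact_mod_cast Real.pi_ne_zero
  rw [Complex.exp_eq_one_iff]
  constructor
  · rintro ⟨n, hn⟩
    have h2 : (k : ℂ) = ℓ * n := by
      push_cast at hn
      field_simp at hn
      linear_combination hn
    have h3 : (k : ℤ) = ℓ * n := by exact_mod_cast h2
    exact Int.natCast_dvd_natCast.mp ⟨n, h3⟩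
  · rintro ⟨m, rfl⟩
    refine ⟨m, ?_⟩
    push_cast
    field_simp

/-- The plane wave `exp (-i a x)`, annihilated by the magnetic horizontal gradient. -/
noncomputable def heisWave (a : ℝ) (p : ℝ × ℝ × ℝ) : ℂ :=
  Complex.exp (-(Complex.I * a * p.1))

theorem contDiff_heisWave (a : ℝ) : ContDiff ℝ (⊤ : ℕ∞) (heisWave a) := by
  unfold heisWave
  have : ContDiff ℝ (⊤ : ℕ∞) fun p : ℝ × ℝ × ℝ => (p.1 : ℂ) :=
    Complex.ofRealCLM.contDiff.comp contDiff_fst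
  exact (contDiff_const.mul this).neg.cexp

theorem hasFDerivAt_heisWave (a : ℝ) (p : ℝ × ℝ × ℝ) :
    HasFDerivAt (heisWave a)
      (heisWave a p • -((Complex.I * a) • Complex.ofRealCLM.comp
        (ContinuousLinearMap.fst ℝ ℝ (ℝ × ℝ)))) p := by
  have : HasFDerivAt (fun p : ℝ × ℝ × ℝ => (p.1 : ℂ))
      (Complex.ofRealCLM.comp (ContinuousLinearMap.fst ℝ ℝ (ℝ × ℝ))) p :=
    (Complex.ofRealCLM.comp (ContinuousLinearMap.fst ℝ ℝ (ℝ × ℝ))).hasFDerivAt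
  exact (this.const_mul (Complex.I * a)).neg.cexp

theorem heisX_heisWave (a : ℝ) (p : ℝ × ℝ × ℝ) :
    heisX (heisWave a) p + Complex.I * a * heisWave a p = 0 := by
  rw [heisX, (hasFDerivAt_heisWave a p).fderiv]
  simp
  ring

theorem heisY_heisWave (a : ℝ) (p : ℝ × ℝ × ℝ) : heisY (heisWave a) p = 0 := by
  rw [heisY, (hasFDerivAt_heisWave a p).fderiv]
  simp

theorem heisInvariant_heisWave {k : ℕ} {a : ℝ} (h : Complex.exp (Complex.I * a * k) = 1) :
    HeisInvariant k (heisWave a) := by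
  intro x y z
  refine ⟨?_, rfl, rfl⟩
  simp only [heisWave]
  push_cast
  rw [mul_add, neg_add, Complex.exp_add, Complex.exp_neg (Complex.I * a * k), h]
  simp

/-- **Aharonov–Bohm detection of the Chern class.**  On `Γ_k \ ℍ¹` with magnetic
potential `(2π/ℓ) dx`, the first eigenvalue of the magnetic horizontal Laplacian
vanishes if and only if `ℓ` divides `k`. -/
theorem heisenberg_lambda1_zero_iff_dvd (k ℓ : ℕ) (hk : 1 ≤ k) (hℓ : 1 ≤ ℓ) :
    heisLambda1 k (2 * Real.pi / ℓ) 0 = 0 ↔ ℓ ∣ k := by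
  have hrw : ∀ (φ : ℝ × ℝ × ℝ → ℂ) (a : ℝ), ContDiff ℝ 1 φ → (∫ p in heisF k,
      (‖heisX φ p + Complex.I * (a : ℂ) * φ p‖ ^ 2 +
        ‖heisY φ p + Complex.I * ((0 : ℝ) : ℂ) * φ p‖ ^ 2)) = heisEnergy k φ a := by
    intro φ a hφ
    have hX := continuous_heisX hφ
    have hY := continuous_heisY hφ
    have hc := hφ.continuous
    have c1 : Continuous fun p => ‖heisX φ p + Complex.I * (a : ℂ) * φ p‖ ^ 2 := by fun_prop
    simp only [Complex.ofReal_zero, mul_zero, zero_mul, add_zero]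
    exact integral_add (integrableOn_heisF k c1) (integrableOn_heisF k (hY.norm_sq))
  have hone : (1 : WithTop ℕ∞) ≤ ((⊤ : ℕ∞) : WithTop ℕ∞) := by exact_mod_cast le_top
  rw [← exp_holonomy_eq_one_iff hℓ]
  set a : ℝ := 2 * Real.pi / ℓ
  constructor
  · intro h0
    by_contra hne
    have hpos : 0 < ‖Complex.exp (Complex.I * a * k) - 1‖ ^ 2 :=
      pow_pos (norm_pos_iff.mpr (sub_ne_zero.mpr hne)) 2
    have hC : (0 : ℝ) < 2 * k ^ 2 + 64 := by positivity
    refine (div_pos hpos hC).not_ge ?_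
    rw [← h0]
    refine le_csInf ⟨_, fun _ => 1, contDiff_const, fun _ _ _ => ⟨rfl, rfl, rfl⟩,
      ⟨0, one_ne_zero⟩, rfl⟩ ?_
    rintro r ⟨φ, hφ, hinv, hφ0, rfl⟩
    have hφ1 : ContDiff ℝ 1 φ := hφ.of_le hone
    rw [hrw φ a hφ1, div_le_div_iff₀ hC (setIntegral_norm_sq_pos hk hφ.continuous hinv hφ0),
      mul_comm (heisEnergy k φ a)]
    exact norm_holonomy_mul_setIntegral_le hφ1 hinv a
  · intro h1
    refine IsLeast.csInf_eq ⟨⟨heisWave a, contDiff_heisWave a, heisInvariant_heisWave h1,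
      ⟨0, Complex.exp_ne_zero _⟩, ?_⟩, ?_⟩
    · simp [heisX_heisWave, heisY_heisWave]
    · rintro r ⟨φ, -, -, -, rfl⟩
      exact div_nonneg (integral_nonneg fun p => by positivity)
        (integral_nonneg fun p => by positivity)
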